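/- arXiv:1509.04698 — 2 statements merged into one kernel-verified Lean document; each statement's English description precedes it below -/
import Mathlib

section
/- In the optimal solution of the weighted sum rate problem for the broadcast channel, the weak user's rate is monotonically increasing: let 0 < μ₁ < μ₂ and suppose all harvested energies E_i, Ē_{1i}, Ē_{2i} are strictly positive. If (r₁, r₂) is a feasible rate policy maximizing μ₁·∑_{i=1}^N r_{1i} + μ₂·∑_{i=1}^N r_{2i} over all feasible policies, then the sequence i ↦ r_{2i} is nondecreasing in i. -/
open Finset

/-- Minimum transmit power needed to deliver rates `r1` (strong user) and `r2`
(weak user) on the degraded Gaussian BC with noise variances `1` and `σ2 > 1`. -/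
noncomputable def Fmin (σ2 r1 r2 : ℝ) : ℝ :=
  (σ2 - 1) * (2 : ℝ) ^ (2 * r2) + (2 : ℝ) ^ (2 * (r1 + r2)) - σ2

/-- Feasibility of a rate policy `(r1, r2)` for the two-user degraded BC with
transmitter energies `E`, strong-receiver energies `Eb1` and weak-receiver
energies `Eb2` (decoding cost `φ(r) = 2^{2r} − 1`). -/
def BCFeasible (N : ℕ) (σ2 : ℝ) (E Eb1 Eb2 : ℕ → ℝ) (r1 r2 : ℕ → ℝ) : Prop :=
  (∀ i ∈ Finset.Icc 1 N, 0 ≤ r1 i) ∧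
  (∀ i ∈ Finset.Icc 1 N, 0 ≤ r2 i) ∧
  (∀ k ∈ Finset.Icc 1 N,
      ∑ i ∈ Finset.Icc 1 k, Fmin σ2 (r1 i) (r2 i) ≤ ∑ i ∈ Finset.Icc 1 k, E i) ∧
  (∀ k ∈ Finset.Icc 1 N,
      ∑ i ∈ Finset.Icc 1 k, ((2 : ℝ) ^ (2 * (r1 i + r2 i)) - 1) ≤
        ∑ i ∈ Finset.Icc 1 k, Eb1 i) ∧
  (∀ k ∈ Finset.Icc 1 N,
      ∑ i ∈ Finset.Icc 1 k, ((2 : ℝ) ^ (2 * r2 i) - 1) ≤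
        ∑ i ∈ Finset.Icc 1 k, Eb2 i)


lemma bc_sum_two (i k : ℕ) (f g : ℕ → ℝ) (h : ∀ l, l ≠ i → l ≠ i + 1 → f l = g l) :
    ∑ l ∈ Finset.Icc 1 k, f l = ∑ l ∈ Finset.Icc 1 k, g l
      + (if i ∈ Finset.Icc 1 k then f i - g i else 0)
      + (if i + 1 ∈ Finset.Icc 1 k then f (i+1) - g (i+1) else 0) := by
  have e : ∀ l ∈ Finset.Icc 1 k, f l = g l + (if l = i then f i - g i else 0)
      + (if l = i + 1 then f (i+1) - g (i+1) else 0) := by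
    intro l _
    by_cases h1 : l = i
    · subst h1; simp
    · by_cases h2 : l = i + 1
      · subst h2; simp
      · simp [h1, h2, h l h1 h2]
  rw [Finset.sum_congr rfl e, Finset.sum_add_distrib, Finset.sum_add_distrib,
    Finset.sum_ite_eq', Finset.sum_ite_eq']

lemma bc_sum_le (i k : ℕ) (hi : 1 ≤ i) (f g : ℕ → ℝ)
    (h : ∀ l, l ≠ i → l ≠ i + 1 → f l = g l)
    (h1 : f i ≤ g i) (h2 : f i + f (i+1) ≤ g i + g (i+1)) :
    ∑ l ∈ Finset.Icc 1 k, f l ≤ ∑ l ∈ Finset.Icc 1 k, g l := by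
  rw [bc_sum_two i k f g h]
  simp only [Finset.mem_Icc]
  split_ifs with h3 h4 h4
  · linarith
  · linarith
  · omega
  · linarith

lemma bc_mono {x y : ℝ} : (2:ℝ) ^ (2 * x) ≤ (2:ℝ) ^ (2 * y) ↔ x ≤ y := by
  rw [Real.rpow_le_rpow_left_iff (by norm_num)]
  constructor <;> intro h <;> linarith

lemma bc_mean (x y : ℝ) : ∃ m : ℝ, (2:ℝ) ^ (2 * m) * 2 = (2:ℝ) ^ (2 * x) + (2:ℝ) ^ (2 * y) ∧
    x + y ≤ 2 * m ∧ (x ≠ y → x + y < 2 * m) := by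
  have hx : (0:ℝ) < (2:ℝ) ^ x := by positivity
  have hy : (0:ℝ) < (2:ℝ) ^ y := by positivity
  have ex : (2:ℝ) ^ (2 * x) = (2:ℝ) ^ x * (2:ℝ) ^ x := by
    rw [two_mul, Real.rpow_add (by norm_num)]
  have ey : (2:ℝ) ^ (2 * y) = (2:ℝ) ^ y * (2:ℝ) ^ y := by
    rw [two_mul, Real.rpow_add (by norm_num)]
  have exy : (2:ℝ) ^ (x + y) = (2:ℝ) ^ x * (2:ℝ) ^ y := Real.rpow_add (by norm_num) x y
  have em : (2:ℝ) ^ (2 * (Real.logb 2 (((2:ℝ) ^ (2 * x) + (2:ℝ) ^ (2 * y)) / 2) / 2)) =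
      ((2:ℝ) ^ (2 * x) + (2:ℝ) ^ (2 * y)) / 2 := by
    rw [mul_div_cancel₀ _ (by norm_num : (2:ℝ) ≠ 0)]
    exact Real.rpow_logb (by norm_num) (by norm_num) (by positivity)
  refine ⟨Real.logb 2 (((2:ℝ) ^ (2 * x) + (2:ℝ) ^ (2 * y)) / 2) / 2, ?_, ?_, ?_⟩
  · rw [em]; ring
  · rw [← Real.rpow_le_rpow_left_iff (by norm_num : (1:ℝ) < 2), em, exy, ex, ey]
    nlinarith [sq_nonneg ((2:ℝ) ^ x - (2:ℝ) ^ y)]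
  · intro hne
    rw [← Real.rpow_lt_rpow_left_iff (by norm_num : (1:ℝ) < 2), em, exy, ex, ey]
    have : (2:ℝ) ^ x - (2:ℝ) ^ y ≠ 0 := by
      rw [sub_ne_zero]
      intro h
      apply hne
      apply le_antisymm
      · exact (Real.rpow_le_rpow_left_iff (by norm_num : (1:ℝ) < 2)).1 h.le
      · exact (Real.rpow_le_rpow_left_iff (by norm_num : (1:ℝ) < 2)).1 h.ge
    have := sq_pos_of_ne_zero this
    nlinarith

lemma bc_two (x0 x1 s0 s1 : ℝ) (h : x1 < x0) (h1 : 0 ≤ x1) (g0 : x0 ≤ s0) (g1 : x1 ≤ s1) :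
    ∃ m B0 B1 : ℝ, 0 ≤ m ∧ m ≤ B0 ∧ m ≤ B1 ∧ m ≤ x0 ∧
      (2:ℝ) ^ (2 * m) * 2 = (2:ℝ) ^ (2 * x0) + (2:ℝ) ^ (2 * x1) ∧ x0 + x1 < 2 * m ∧
      B0 ≤ s0 ∧ s0 + s1 ≤ B0 + B1 ∧
      (2:ℝ) ^ (2 * B0) + (2:ℝ) ^ (2 * B1) = (2:ℝ) ^ (2 * s0) + (2:ℝ) ^ (2 * s1) := by
  obtain ⟨m, hm, -, hlt⟩ := bc_mean x0 x1
  have hlt := hlt h.ne'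
  have hm0 : m ≤ x0 := by
    rw [← bc_mono]
    have := bc_mono.2 h.le
    linarith
  rcases lt_or_ge s0 s1 with hs | hs
  · exact ⟨m, s0, s1, by linarith, by linarith, by linarith, hm0, hm, hlt, le_rfl, le_rfl, rfl⟩
  · obtain ⟨B, hB, hle, -⟩ := bc_mean s0 s1
    have hB0 : B ≤ s0 := by
      rw [← bc_mono]
      have := bc_mono.2 hs
      linarith
    have hmB : m ≤ B := by
      rw [← bc_mono]
      have := bc_mono.2 g0
      have := bc_mono.2 g1
      linarith
    exact ⟨m, B, B, by linarith, hmB, hmB, hm0, hm, hlt, hB0, by linarith, by linarith⟩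

/-- in the optimal solution of the BC weighted sum rate problem with
`0 < μ1 < μ2` and strictly positive energies, the weak user's rate is nondecreasing in time. -/
theorem bc_optimal_weak_rate_monotone
    (N : ℕ) (hN : 1 ≤ N)
    (σ2 : ℝ) (hσ2 : 1 < σ2)
    (E Eb1 Eb2 : ℕ → ℝ)
    (hE : ∀ i ∈ Finset.Icc 1 N, 0 < E i)
    (hEb1 : ∀ i ∈ Finset.Icc 1 N, 0 < Eb1 i)
    (hEb2 : ∀ i ∈ Finset.Icc 1 N, 0 < Eb2 i)
    (μ1 μ2 : ℝ) (hμ1 : 0 < μ1) (hμ12 : μ1 < μ2)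
    (r1 r2 : ℕ → ℝ)
    (hfeas : BCFeasible N σ2 E Eb1 Eb2 r1 r2)
    (hopt : ∀ r1' r2' : ℕ → ℝ, BCFeasible N σ2 E Eb1 Eb2 r1' r2' →
        μ1 * ∑ i ∈ Finset.Icc 1 N, r1' i + μ2 * ∑ i ∈ Finset.Icc 1 N, r2' i ≤
        μ1 * ∑ i ∈ Finset.Icc 1 N, r1 i + μ2 * ∑ i ∈ Finset.Icc 1 N, r2 i) :
    ∀ i j : ℕ, 1 ≤ i → i ≤ j → j ≤ N → r2 i ≤ r2 j := by
  obtain ⟨p1, p2, c1, c2, c3⟩ := hfeas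
  have step : ∀ i, 1 ≤ i → i + 1 ≤ N → r2 i ≤ r2 (i + 1) := by
    intro i hi hiN
    by_contra hcon
    push Not at hcon
    have mi : i ∈ Finset.Icc 1 N := Finset.mem_Icc.2 ⟨hi, by omega⟩
    have mi' : i + 1 ∈ Finset.Icc 1 N := Finset.mem_Icc.2 ⟨by omega, hiN⟩
    obtain ⟨m, B0, B1, hm, hB0, hB1, hmx, em, lm, hs, ls, es⟩ :=
      bc_two (r2 i) (r2 (i+1)) (r1 i + r2 i) (r1 (i+1) + r2 (i+1)) hcon (p2 _ mi')
        (by linarith [p1 _ mi]) (by linarith [p1 _ mi'])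
    obtain ⟨q2, hq2⟩ : ∃ q : ℕ → ℝ, q = fun k => if k = i then m else if k = i + 1 then m
      else r2 k := ⟨_, rfl⟩
    obtain ⟨q1, hq1⟩ : ∃ q : ℕ → ℝ, q = fun k => if k = i then B0 - m else
      if k = i + 1 then B1 - m else r1 k := ⟨_, rfl⟩
    have a0 : q2 i = m := by simp [hq2]
    have a1 : q2 (i+1) = m := by simp [hq2]
    have b0 : q1 i = B0 - m := by simp [hq1]
    have b1 : q1 (i+1) = B1 - m := by simp [hq1]
    have ao : ∀ l, l ≠ i → l ≠ i + 1 → q2 l = r2 l := by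
      intro l h1 h2; simp [hq2, h1, h2]
    have bo : ∀ l, l ≠ i → l ≠ i + 1 → q1 l = r1 l := by
      intro l h1 h2; simp [hq1, h1, h2]
    have k1 := bc_mono.2 hmx
    have k2 := bc_mono.2 hs
    have hσ : 0 < σ2 - 1 := by linarith
    have k3 := mul_le_mul_of_nonneg_left k1 hσ.le
    have k4 : (σ2 - 1) * ((2:ℝ) ^ (2 * m) * 2) = (σ2 - 1) * (2:ℝ) ^ (2 * r2 i) +
        (σ2 - 1) * (2:ℝ) ^ (2 * r2 (i+1)) := by rw [em]; ring
    have hf : BCFeasible N σ2 E Eb1 Eb2 q1 q2 := by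
      refine ⟨?_, ?_, ?_, ?_, ?_⟩
      · intro l hl
        by_cases h1 : l = i
        · subst h1; rw [b0]; linarith
        · by_cases h2 : l = i + 1
          · subst h2; rw [b1]; linarith
          · rw [bo l h1 h2]; exact p1 l hl
      · intro l hl
        by_cases h1 : l = i
        · subst h1; rw [a0]; exact hm
        · by_cases h2 : l = i + 1
          · subst h2; rw [a1]; exact hm
          · rw [ao l h1 h2]; exact p2 l hl
      · intro k hk
        refine le_trans (bc_sum_le i k hi _ _ ?_ ?_ ?_) (c1 k hk)
        · intro l h1 h2
          rw [ao l h1 h2, bo l h1 h2]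
        · simp only [Fmin, a0, b0, sub_add_cancel]
          linarith
        · simp only [Fmin, a0, b0, a1, b1, sub_add_cancel]
          linarith
      · intro k hk
        refine le_trans (bc_sum_le i k hi _ _ ?_ ?_ ?_) (c2 k hk)
        · intro l h1 h2
          simp only [ao l h1 h2, bo l h1 h2]
        · simp only [a0, b0, sub_add_cancel]
          linarith
        · simp only [a0, b0, a1, b1, sub_add_cancel]
          linarith
      · intro k hk
        refine le_trans (bc_sum_le i k hi _ _ ?_ ?_ ?_) (c3 k hk)
        · intro l h1 h2
          simp only [ao l h1 h2]
        · simp only [a0]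
          linarith
        · simp only [a0, a1]
          linarith
    have ho := hopt q1 q2 hf
    rw [bc_sum_two i N q1 r1 bo, bc_sum_two i N q2 r2 ao, if_pos mi, if_pos mi, if_pos mi',
      if_pos mi', a0, a1, b0, b1] at ho
    have t1 := mul_pos (sub_pos.2 hμ12) (sub_pos.2 lm)
    have t2 := mul_nonneg hμ1.le (sub_nonneg.2 ls)
    nlinarith
  intro i j hi hij
  induction j, hij using Nat.le_induction with
  | base => intro _; exact le_rfl
  | succ n hn ih =>
    intro h
    exact (ih (by omega)).trans (step n (by omega) h)
end

section
/- The inner-problem value function of the broadcast channel weighted sum rate problem is nonincreasing and concave: define, for p₂ in the convex set D = { p₂ ∈ [0,∞)^N : ∑_{i=1}^k p_{2i} ≤ min(∑_{i=1}^k Ē_{1i}, (1/σ²)·∑_{i=1}^k E_i) for all k }, the cumulative levels B_k(p₂) := min{ ∑_{i=1}^k Ē_{1i}, ∑_{i=1}^k (E_i − (σ²−1)·p_{2i}) } and H(p₂) := sup{ ∑_{i=1}^N g(p_{ti}) : p_t ∈ ℝ^N, p_{ti} ≥ p_{2i} for all i, and ∑_{i=1}^k p_{ti} ≤ B_k(p₂)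 for all k = 1,…,N }. Then H is concave on D, and H is nonincreasing with respect to the componentwise order: if p₂, p₂′ ∈ D with p_{2i} ≤ p′_{2i} for all i, then H(p₂′) ≤ H(p₂). -/
open Finset

/-- The rate function `g(p) = (1/2)·log₂(1+p)`. -/
noncomputable def gfun (p : ℝ) : ℝ := Real.logb 2 (1 + p) / 2

open Pointwise in
lemma aux_sSup {A B : Set ℝ} (hA : A.Nonempty) (hB : B.Nonempty) {a b c : ℝ}
    (ha : 0 ≤ a) (hb : 0 ≤ b) (h : ∀ x ∈ A, ∀ y ∈ B, a * x + b * y ≤ c) :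
    a * sSup A + b * sSup B ≤ c := by
  have h1 : sSup (a • A) = a * sSup A := Real.sSup_smul_of_nonneg ha A
  have h2 : sSup (b • B) = b * sSup B := Real.sSup_smul_of_nonneg hb B
  have h3 : sSup (a • A) ≤ c - sSup (b • B) := by
    apply csSup_le hA.smul_set
    rintro _ ⟨x, hx, rfl⟩
    have h4 : sSup (b • B) ≤ c - a * x := by
      apply csSup_le hB.smul_set
      rintro _ ⟨y, hy, rfl⟩
      have := h x hx y hy
      simp only [smul_eq_mul]
      linarith
    simp only [smul_eq_mul]
    linarith
  linarith

lemma gfun_mono {x y : ℝ} (hx : 0 ≤ x) (hxy : x ≤ y) : gfun x ≤ gfun y := by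
  unfold gfun
  have := Real.logb_le_logb_of_le (b := 2) (by norm_num) (by linarith : 0 < 1 + x)
    (by linarith : 1 + x ≤ 1 + y)
  linarith

lemma gfun_concave {x y a b : ℝ} (hx : 0 ≤ x) (hy : 0 ≤ y) (ha : 0 ≤ a) (hb : 0 ≤ b)
    (hab : a + b = 1) : a * gfun x + b * gfun y ≤ gfun (a * x + b * y) := by
  have h := strictConcaveOn_log_Ioi.concaveOn.2 (x := 1 + x) (y := 1 + y)
    (Set.mem_Ioi.2 (by linarith)) (Set.mem_Ioi.2 (by linarith)) ha hb hab
  simp only [smul_eq_mul] at h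
  have e : a * (1 + x) + b * (1 + y) = 1 + (a * x + b * y) := by linear_combination hab
  rw [e] at h
  unfold gfun Real.logb
  have hl : 0 < Real.log 2 := Real.log_pos (by norm_num)
  have h2 : a * (Real.log (1 + x) / Real.log 2 / 2) + b * (Real.log (1 + y) / Real.log 2 / 2)
    = (a * Real.log (1 + x) + b * Real.log (1 + y)) / Real.log 2 / 2 := by ring
  rw [h2]
  gcongr

/-- feasible values -/
def FS (N : ℕ) (σ2 : ℝ) (E Eb1 p2 : ℕ → ℝ) : Set ℝ := {S : ℝ | ∃ pt : ℕ → ℝ,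
          (∀ i ∈ Finset.Icc 1 N, p2 i ≤ pt i) ∧
          (∀ k ∈ Finset.Icc 1 N,
              ∑ i ∈ Finset.Icc 1 k, pt i ≤
                min (∑ i ∈ Finset.Icc 1 k, Eb1 i)
                  (∑ i ∈ Finset.Icc 1 k, (E i - (σ2 - 1) * p2 i))) ∧
          S = ∑ i ∈ Finset.Icc 1 N, gfun (pt i)}

/-- domain -/
def DS (N : ℕ) (σ2 : ℝ) (E Eb1 : ℕ → ℝ) : Set (ℕ → ℝ) :=
      {p2 : ℕ → ℝ | (∀ i ∈ Finset.Icc 1 N, 0 ≤ p2 i) ∧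
        (∀ k ∈ Finset.Icc 1 N,
            ∑ i ∈ Finset.Icc 1 k, p2 i ≤
              min (∑ i ∈ Finset.Icc 1 k, Eb1 i)
                ((1 / σ2) * ∑ i ∈ Finset.Icc 1 k, E i))}

lemma FS_nonempty {N : ℕ} {σ2 : ℝ} (hσ2 : 1 < σ2) {E Eb1 p2 : ℕ → ℝ}
    (h : p2 ∈ DS N σ2 E Eb1) : (FS N σ2 E Eb1 p2).Nonempty := by
  refine ⟨_, p2, fun i _ => le_rfl, fun k hk => ?_, rfl⟩
  have h1 := le_min_iff.1 (h.2 k hk)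
  refine le_min h1.1 ?_
  have h2 := h1.2
  rw [Finset.sum_sub_distrib, ← Finset.mul_sum]
  rw [one_div, inv_mul_eq_div, le_div_iff₀ (by linarith)] at h2
  linarith

lemma FS_bdd {N : ℕ} (hN : 1 ≤ N) {σ2 : ℝ} {E Eb1 p2 : ℕ → ℝ}
    (h : p2 ∈ DS N σ2 E Eb1) : BddAbove (FS N σ2 E Eb1 p2) := by
  refine ⟨∑ i ∈ Finset.Icc 1 N, gfun (∑ i ∈ Finset.Icc 1 N, Eb1 i), ?_⟩
  rintro _ ⟨pt, h1, h2, rfl⟩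
  have h0 : ∀ i ∈ Finset.Icc 1 N, 0 ≤ pt i := fun i hi => (h.1 i hi).trans (h1 i hi)
  refine Finset.sum_le_sum fun i hi => gfun_mono (h0 i hi) ?_
  exact (Finset.single_le_sum h0 hi).trans
    ((h2 N (Finset.mem_Icc.2 ⟨hN, le_rfl⟩)).trans (min_le_left _ _))

lemma DS_convex (N : ℕ) (σ2 : ℝ) (E Eb1 : ℕ → ℝ) : Convex ℝ (DS N σ2 E Eb1) := by
  intro x hx y hy a b ha hb hab
  refine ⟨fun i hi => ?_, fun k hk => ?_⟩
  · have := mul_nonneg ha (hx.1 i hi)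
    have := mul_nonneg hb (hy.1 i hi)
    simp only [Pi.add_apply, Pi.smul_apply, smul_eq_mul]
    linarith
  · simp only [Pi.add_apply, Pi.smul_apply, smul_eq_mul, Finset.sum_add_distrib,
      ← Finset.mul_sum]
    calc _ ≤ a * _ + b * _ := add_le_add (mul_le_mul_of_nonneg_left (hx.2 k hk) ha)
            (mul_le_mul_of_nonneg_left (hy.2 k hk) hb)
      _ = _ := by rw [← add_mul, hab, one_mul]

lemma FS_combo {N : ℕ} {σ2 : ℝ} {E Eb1 x y : ℕ → ℝ}
    (hx : x ∈ DS N σ2 E Eb1) (hy : y ∈ DS N σ2 E Eb1) {a b : ℝ} (ha : 0 ≤ a) (hb : 0 ≤ b)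
    (hab : a + b = 1) {s t : ℝ} (hs : s ∈ FS N σ2 E Eb1 x) (ht : t ∈ FS N σ2 E Eb1 y) :
    ∃ u ∈ FS N σ2 E Eb1 (a • x + b • y), a * s + b * t ≤ u := by
  obtain ⟨p, p1, p2, rfl⟩ := hs
  obtain ⟨q, q1, q2, rfl⟩ := ht
  refine ⟨_, ⟨a • p + b • q, fun i hi => ?_, fun k hk => ?_, rfl⟩, ?_⟩
  · have := mul_le_mul_of_nonneg_left (p1 i hi) ha
    have := mul_le_mul_of_nonneg_left (q1 i hi) hb
    simp only [Pi.add_apply, Pi.smul_apply, smul_eq_mul]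
    linarith
  · obtain ⟨u1, u2⟩ := le_min_iff.1 (p2 k hk)
    obtain ⟨v1, v2⟩ := le_min_iff.1 (q2 k hk)
    simp only [Pi.add_apply, Pi.smul_apply, smul_eq_mul, Finset.sum_add_distrib,
      Finset.sum_sub_distrib, ← Finset.mul_sum] at u2 v2 ⊢
    have hb' : b = 1 - a := by linarith
    refine le_min ?_ ?_
    · have := mul_le_mul_of_nonneg_left u1 ha
      have := mul_le_mul_of_nonneg_left v1 hb
      subst hb'
      linarith
    · have := mul_le_mul_of_nonneg_left u2 ha
      have := mul_le_mul_of_nonneg_left v2 hb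
      subst hb'
      linarith
  · rw [Finset.mul_sum, Finset.mul_sum, ← Finset.sum_add_distrib]
    refine Finset.sum_le_sum fun i hi => ?_
    exact gfun_concave ((hx.1 i hi).trans (p1 i hi)) ((hy.1 i hi).trans (q1 i hi)) ha hb hab

lemma FS_anti {N : ℕ} {σ2 : ℝ} (hσ2 : 1 < σ2) {E Eb1 x y : ℕ → ℝ}
    (h : ∀ i ∈ Finset.Icc 1 N, x i ≤ y i) : FS N σ2 E Eb1 y ⊆ FS N σ2 E Eb1 x := by
  rintro _ ⟨p, p1, p2, rfl⟩
  refine ⟨p, fun i hi => (h i hi).trans (p1 i hi), fun k hk => (p2 k hk).trans ?_, rfl⟩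
  refine min_le_min le_rfl (Finset.sum_le_sum fun i hi => ?_)
  have hi' : i ∈ Finset.Icc 1 N := by
    rw [Finset.mem_Icc] at *
    omega
  have := mul_le_mul_of_nonneg_left (h i hi') (by linarith : 0 ≤ σ2 - 1)
  linarith

/-- the inner-problem value function `H(p2)` of the BC weighted sum rate
problem is concave on `D` and nonincreasing with respect to the componentwise order. -/
theorem bc_inner_value_concave_antitone
    (N : ℕ) (hN : 1 ≤ N)
    (σ2 : ℝ) (hσ2 : 1 < σ2)
    (E Eb1 Eb2 : ℕ → ℝ)
    (hE : ∀ i ∈ Finset.Icc 1 N, 0 ≤ E i)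
    (hEb1 : ∀ i ∈ Finset.Icc 1 N, 0 ≤ Eb1 i)
    (hEb2 : ∀ i ∈ Finset.Icc 1 N, 0 ≤ Eb2 i) :
    ConcaveOn ℝ
      {p2 : ℕ → ℝ | (∀ i ∈ Finset.Icc 1 N, 0 ≤ p2 i) ∧
        (∀ k ∈ Finset.Icc 1 N,
            ∑ i ∈ Finset.Icc 1 k, p2 i ≤
              min (∑ i ∈ Finset.Icc 1 k, Eb1 i)
                ((1 / σ2) * ∑ i ∈ Finset.Icc 1 k, E i))}
      (fun p2 => sSup {S : ℝ | ∃ pt : ℕ → ℝ,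
          (∀ i ∈ Finset.Icc 1 N, p2 i ≤ pt i) ∧
          (∀ k ∈ Finset.Icc 1 N,
              ∑ i ∈ Finset.Icc 1 k, pt i ≤
                min (∑ i ∈ Finset.Icc 1 k, Eb1 i)
                  (∑ i ∈ Finset.Icc 1 k, (E i - (σ2 - 1) * p2 i))) ∧
          S = ∑ i ∈ Finset.Icc 1 N, gfun (pt i)}) ∧
    (∀ p2 p2' : ℕ → ℝ,
      ((∀ i ∈ Finset.Icc 1 N, 0 ≤ p2 i) ∧
        (∀ k ∈ Finset.Icc 1 N,
            ∑ i ∈ Finset.Icc 1 k, p2 i ≤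
              min (∑ i ∈ Finset.Icc 1 k, Eb1 i)
                ((1 / σ2) * ∑ i ∈ Finset.Icc 1 k, E i))) →
      ((∀ i ∈ Finset.Icc 1 N, 0 ≤ p2' i) ∧
        (∀ k ∈ Finset.Icc 1 N,
            ∑ i ∈ Finset.Icc 1 k, p2' i ≤
              min (∑ i ∈ Finset.Icc 1 k, Eb1 i)
                ((1 / σ2) * ∑ i ∈ Finset.Icc 1 k, E i))) →
      (∀ i ∈ Finset.Icc 1 N, p2 i ≤ p2' i) →
      sSup {S : ℝ | ∃ pt : ℕ → ℝ,
          (∀ i ∈ Finset.Icc 1 N, p2' i ≤ pt i) ∧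
          (∀ k ∈ Finset.Icc 1 N,
              ∑ i ∈ Finset.Icc 1 k, pt i ≤
                min (∑ i ∈ Finset.Icc 1 k, Eb1 i)
                  (∑ i ∈ Finset.Icc 1 k, (E i - (σ2 - 1) * p2' i))) ∧
          S = ∑ i ∈ Finset.Icc 1 N, gfun (pt i)} ≤
      sSup {S : ℝ | ∃ pt : ℕ → ℝ,
          (∀ i ∈ Finset.Icc 1 N, p2 i ≤ pt i) ∧
          (∀ k ∈ Finset.Icc 1 N,
              ∑ i ∈ Finset.Icc 1 k, pt i ≤
                min (∑ i ∈ Finset.Icc 1 k, Eb1 i)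
                  (∑ i ∈ Finset.Icc 1 k, (E i - (σ2 - 1) * p2 i))) ∧
          S = ∑ i ∈ Finset.Icc 1 N, gfun (pt i)}) := by
  refine ⟨⟨DS_convex N σ2 E Eb1, ?_⟩, ?_⟩
  · intro x hx y hy a b ha hb hab
    change a * sSup (FS N σ2 E Eb1 x) + b * sSup (FS N σ2 E Eb1 y)
      ≤ sSup (FS N σ2 E Eb1 (a • x + b • y))
    refine aux_sSup (FS_nonempty hσ2 hx) (FS_nonempty hσ2 hy) ha hb fun s hs t ht => ?_
    obtain ⟨u, hu, hle⟩ := FS_combo hx hy ha hb hab hs ht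
    exact hle.trans (le_csSup (FS_bdd hN (DS_convex N σ2 E Eb1 hx hy ha hb hab)) hu)
  · intro x y hx hy hxy
    exact csSup_le_csSup (FS_bdd (E := E) (σ2 := σ2) hN hx) (FS_nonempty hσ2 hy)
      (FS_anti hσ2 hxy)
end
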